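/- Let f be a homeomorphism of ℝ² such that f maps every C¹ curve to a C¹ curve and such that f induces a homeomorphism of projective tangent spaces at every point. Then for every simple closed C¹ curve Γ and every q ∈ f⁻¹(Γ), there exists ℓ ∈ ℙ(ℝ²) such that the secant directions [x − q] ∈ ℙ(ℝ²) tend to ℓ as x → q within f⁻¹(Γ) \ {q}; that is, the preimage f⁻¹(Γ) has a well-defined tangent line at each of its points. -/

import Mathlib

open Filter Topology

noncomputable section

abbrev Plane : Type := ℝ × ℝ

abbrev ProjLine : Type := Projectivization ℝ Plane

instance : TopologicalSpace ProjLine := instTopologicalSpaceQuotient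

/-- A regular (C¹, 1-periodic, injective on `[0,1)`, nowhere-vanishing derivative)
parameterization of a simple closed C¹ curve. -/
def IsRegParam (γ : ℝ → Plane) : Prop :=
  ContDiff ℝ 1 γ ∧ Function.Periodic γ 1 ∧ Set.InjOn γ (Set.Ico 0 1) ∧ ∀ t, deriv γ t ≠ 0

/-- `Γ` is a simple closed C¹ curve. -/
def IsC1Curve (Γ : Set Plane) : Prop := ∃ γ : ℝ → Plane, IsRegParam γ ∧ Γ = Set.range γ

/-- `Γ` is a simple closed C¹ curve through `p` with tangent line `ℓ` at `p`. -/
def TangentAt (Γ : Set Plane) (p : Plane) (ℓ : ProjLine) : Prop :=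
  ∃ (γ : ℝ → Plane) (t₀ : ℝ) (h : IsRegParam γ),
    Γ = Set.range γ ∧ γ t₀ = p ∧ ℓ = Projectivization.mk ℝ (deriv γ t₀) (h.2.2.2 t₀)

/-- `f` maps every simple closed C¹ curve to a simple closed C¹ curve. -/
def MapsC1 (f : Plane → Plane) : Prop := ∀ Γ : Set Plane, IsC1Curve Γ → IsC1Curve (f '' Γ)

/-- Membership in `Homeo¹(ℝ²)`. -/
def InHomeo1 (f : Plane ≃ₜ Plane) : Prop := MapsC1 ⇑f ∧ MapsC1 ⇑f.symm

/-- `φ` is a homeomorphism of projective tangent spaces induced by `f` at `p`. -/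
def InducesAt (f : Plane → Plane) (p : Plane) (φ : ProjLine ≃ₜ ProjLine) : Prop :=
  ∀ (Γ : Set Plane) (ℓ : ProjLine), TangentAt Γ p ℓ →
    IsC1Curve (f '' Γ) ∧ TangentAt (f '' Γ) (f p) (φ ℓ)

/-- The secant direction from `q` to `x` (junk value if `x = q`). -/
def secantDir (q x : Plane) : ProjLine :=
  if h : x = q then Projectivization.mk ℝ (1, 0) (by simp) else
    Projectivization.mk ℝ (x - q) (sub_ne_zero.mpr h)

/-- The sequence `x` converges along the line `ℓ` to `p`. -/
def ConvAlong (p : Plane) (ℓ : ProjLine) (x : ℕ → Plane) : Prop :=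
  (∀ n, x n ≠ p) ∧ Tendsto x atTop (𝓝 p) ∧
    Tendsto (fun n => secantDir p (x n)) atTop (𝓝 ℓ)

/-- `(x, k)` is a transverse sequence for `(p, ℓ)`. -/
def TransverseFor (p : Plane) (ℓ : ProjLine) (x : ℕ → Plane) (k : ℕ → ProjLine) : Prop :=
  ConvAlong p ℓ x ∧
    ∀ φ : ℕ → ℕ, StrictMono φ →
      ¬ Tendsto (fun n => (x (φ n), k (φ n))) atTop (𝓝 (p, ℓ))

/-- `(x, k)` is a transverse sequence. -/
def Transverse (x : ℕ → Plane) (k : ℕ → ProjLine) : Prop := ∃ p ℓ, TransverseFor p ℓ x k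

/-- The two-dimensional cross product. -/
def planeCross (u w : Plane) : ℝ := u.1 * w.2 - u.2 * w.1

theorem continuous_planeCross_left (w : Plane) : Continuous fun u => planeCross u w := by
  unfold planeCross; fun_prop

theorem planeCross_smul_left (c : ℝ) (u w : Plane) : planeCross (c • u) w = c * planeCross u w := by
  simp only [planeCross, Prod.smul_fst, Prod.smul_snd, smul_eq_mul]; ring

theorem planeCross_self (u : Plane) : planeCross u u = 0 := by
  unfold planeCross; ring

theorem normSq_pos {v : Plane} (hv : v ≠ 0) : 0 < v.1 ^ 2 + v.2 ^ 2 := by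
  by_contra! h
  exact hv (Prod.ext (by simp; nlinarith [sq_nonneg v.1, sq_nonneg v.2])
    (by simp; nlinarith [sq_nonneg v.1, sq_nonneg v.2]))

theorem mk_eq_mk_of_planeCross_eq_zero {u w : Plane} (hu : u ≠ 0) (hw : w ≠ 0)
    (h : planeCross u w = 0) :
    Projectivization.mk ℝ u hu = Projectivization.mk ℝ w hw := by
  rw [Projectivization.mk_eq_mk_iff']
  have hN := (normSq_pos hw).ne'
  unfold planeCross at h
  refine ⟨(u.1 * w.1 + u.2 * w.2) / (w.1 ^ 2 + w.2 ^ 2), Prod.ext ?_ ?_⟩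
  · simp only [Prod.smul_fst, smul_eq_mul]
    field_simp
    linear_combination (-w.2) * h
  · simp only [Prod.smul_snd, smul_eq_mul]
    field_simp
    linear_combination w.1 * h

/-- The unit vector (for the sup norm) pointing from `q` to `x`. -/
def unitSecant (q x : Plane) : Plane := ‖x - q‖⁻¹ • (x - q)

theorem norm_unitSecant {q x : Plane} (h : x ≠ q) : ‖unitSecant q x‖ = 1 := by
  have : ‖x - q‖ ≠ 0 := norm_ne_zero_iff.mpr (sub_ne_zero.mpr h)
  rw [unitSecant, norm_smul, norm_inv, norm_norm, inv_mul_cancel₀ this]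

theorem norm_smul_unitSecant {q x : Plane} (h : x ≠ q) :
    ‖x - q‖ • unitSecant q x = x - q := by
  have : ‖x - q‖ ≠ 0 := norm_ne_zero_iff.mpr (sub_ne_zero.mpr h)
  rw [unitSecant, smul_inv_smul₀ this]

theorem unitSecant_ne_zero {q x : Plane} (h : x ≠ q) : unitSecant q x ≠ 0 := by
  rw [← norm_ne_zero_iff, norm_unitSecant h]; exact one_ne_zero

theorem secantDir_eq_mk_unitSecant {q x : Plane} (h : x ≠ q) :
    secantDir q x = Projectivization.mk ℝ (unitSecant q x) (unitSecant_ne_zero h) := by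
  rw [secantDir, dif_neg h]
  refine mk_eq_mk_of_planeCross_eq_zero _ _ ?_
  rw [← norm_smul_unitSecant h, planeCross_smul_left, planeCross_self, mul_zero]

theorem exists_subseq_unitSecant_tendsto {q : Plane} {x : ℕ → Plane} (hx : ∀ n, x n ≠ q) :
    ∃ v : Plane, v ≠ 0 ∧ ∃ φ : ℕ → ℕ, StrictMono φ ∧
      Tendsto (fun n => unitSecant q (x (φ n))) atTop (𝓝 v) := by
  obtain ⟨v, hv, φ, hφ, hlim⟩ := (isCompact_sphere (0 : Plane) 1).tendsto_subseq
    (x := fun n => unitSecant q (x n)) fun n => by simp [norm_unitSecant (hx n)]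
  refine ⟨v, ?_, φ, hφ, hlim⟩
  rintro rfl
  simp at hv

theorem tendsto_secantDir_of_unitSecant {q v : Plane} (hv : v ≠ 0) {x : ℕ → Plane}
    (hx : ∀ n, x n ≠ q) (h : Tendsto (fun n => unitSecant q (x n)) atTop (𝓝 v)) :
    Tendsto (fun n => secantDir q (x n)) atTop (𝓝 (Projectivization.mk ℝ v hv)) := by
  have hmk : Continuous fun w : {w : Plane // w ≠ 0} =>
      (Projectivization.mk ℝ w.1 w.2 : ProjLine) := continuous_quotient_mk'
  have hsub : Tendsto (fun n => (⟨unitSecant q (x n), unitSecant_ne_zero (hx n)⟩ :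
      {w : Plane // w ≠ 0})) atTop (𝓝 ⟨v, hv⟩) := tendsto_subtype_rng.mpr h
  refine ((hmk.tendsto _).comp hsub).congr fun n => ?_
  rw [secantDir_eq_mk_unitSecant (hx n)]
  rfl

theorem deriv_eq_of_regParam_eq {γ : ℝ → Plane} (hγ : IsRegParam γ) {s t : ℝ} (h : γ s = γ t) :
    deriv γ s = deriv γ t := by
  have hper : ∀ (r : ℝ) (k : ℤ), γ (r + k) = γ r := fun r k => by
    simpa using hγ.2.1.int_mul k r
  have hmem : ∀ r : ℝ, Int.fract r ∈ Set.Ico (0 : ℝ) 1 := fun r =>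
    ⟨Int.fract_nonneg r, Int.fract_lt_one r⟩
  have hfract : ∀ r : ℝ, γ (Int.fract r) = γ r := fun r => by
    rw [← hper (Int.fract r) ⌊r⌋, Int.fract_add_floor]
  have hst : Int.fract s = Int.fract t :=
    hγ.2.2.1 (hmem s) (hmem t) (by rw [hfract, hfract, h])
  obtain ⟨k, hk⟩ := Int.fract_eq_fract.mp hst
  have hs : s = t + k := by linarith
  rw [hs, ← deriv_comp_add_const γ (k : ℝ) t]
  congr 1
  exact funext fun r => hper r k

theorem planeCross_deriv_eq_zero {γ : ℝ → Plane} (hγ : IsRegParam γ) {t₀ : ℝ} {p u : Plane}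
    (hp : γ t₀ = p) {x : ℕ → Plane} (hxp : ∀ n, x n ≠ p) (hx : Tendsto x atTop (𝓝 p))
    (hmem : ∀ n, x n ∈ Set.range γ)
    (hu : Tendsto (fun n => unitSecant p (x n)) atTop (𝓝 u)) :
    planeCross u (deriv γ t₀) = 0 := by
  have ht : ∀ n, ∃ t ∈ Set.Ico (0 : ℝ) 1, γ t = x n := fun n => by
    obtain ⟨r, hr⟩ := hmem n
    obtain ⟨t, ht, hrt⟩ := hγ.2.1.exists_mem_Ico₀ one_pos r
    exact ⟨t, ht, by rw [← hrt, hr]⟩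
  choose t htI htx using ht
  obtain ⟨s, -, φ, hφ, hs⟩ := (isCompact_Icc (a := (0 : ℝ)) (b := 1)).tendsto_subseq
    (x := t) fun n => Set.Ico_subset_Icc_self (htI n)
  have hγs : γ s = p := by
    refine tendsto_nhds_unique ((hγ.1.continuous.tendsto s).comp hs) ?_
    refine (hx.comp hφ.tendsto_atTop).congr fun n => ?_
    simp [htx]
  rw [← deriv_eq_of_regParam_eq hγ (hγs.trans hp.symm)]
  set d := deriv γ s
  have hd0 : ‖d‖ ≠ 0 := norm_ne_zero_iff.mpr (hγ.2.2.2 s)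
  have hne : ∀ n, t (φ n) ≠ s := fun n h => hxp (φ n) (by rw [← htx, h, hγs])
  have hslope : Tendsto (fun n => slope γ s (t (φ n))) atTop (𝓝 d) := by
    have hder : HasDerivAt γ d s := (hγ.1.differentiable one_ne_zero s).hasDerivAt
    exact (hasDerivAt_iff_tendsto_slope.mp hder).comp
      (tendsto_nhdsWithin_iff.mpr ⟨hs, Eventually.of_forall hne⟩)
  have h1 : Tendsto (fun n => |planeCross (slope γ s (t (φ n))) d| / ‖slope γ s (t (φ n))‖) atTop
      (𝓝 (|planeCross d d| / ‖d‖)) :=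
    (((continuous_planeCross_left d).tendsto d).comp hslope).abs.div hslope.norm hd0
  have h2 : Tendsto (fun n => |planeCross (unitSecant p (x (φ n))) d|) atTop (𝓝 |planeCross u d|) :=
    (((continuous_planeCross_left d).tendsto u).comp (hu.comp hφ.tendsto_atTop)).abs
  have h3 : |planeCross u d| = |planeCross d d| / ‖d‖ := by
    refine tendsto_nhds_unique h2 (h1.congr fun n => ?_)
    have hts : |t (φ n) - s| ≠ 0 := abs_ne_zero.mpr (sub_ne_zero.mpr (hne n))
    have hsec : x (φ n) - p = (t (φ n) - s) • slope γ s (t (φ n)) := by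
      rw [sub_smul_slope, htx, hγs, vsub_eq_sub]
    rw [unitSecant, hsec, planeCross_smul_left, planeCross_smul_left, norm_smul, abs_mul,
      abs_mul, abs_inv, Real.norm_eq_abs, abs_mul, abs_abs, abs_norm]
    have hsl : ‖slope γ s (t (φ n))‖ ≠ 0 := by
      intro h0
      refine hxp (φ n) (sub_eq_zero.mp ?_)
      rw [hsec, norm_eq_zero.mp h0, smul_zero]
    field_simp
  rw [planeCross_self, abs_zero, zero_div] at h3
  exact abs_eq_zero.mp h3

/-- The tangent line of a curve is the only limit of secant directions within the curve. -/
theorem TangentAt.mk_eq {Γ : Set Plane} {p u : Plane} {ℓ : ProjLine} (h : TangentAt Γ p ℓ)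
    (hu0 : u ≠ 0) {x : ℕ → Plane} (hxp : ∀ n, x n ≠ p) (hx : Tendsto x atTop (𝓝 p))
    (hmem : ∀ n, x n ∈ Γ) (hu : Tendsto (fun n => unitSecant p (x n)) atTop (𝓝 u)) :
    Projectivization.mk ℝ u hu0 = ℓ := by
  obtain ⟨γ, t₀, hγ, rfl, hp, rfl⟩ := h
  exact mk_eq_mk_of_planeCross_eq_zero _ _ (planeCross_deriv_eq_zero hγ hp hxp hx hmem hu)

theorem exists_subseq_geometric {a c : ℕ → ℝ} (ha0 : ∀ n, a n ≠ 0) (ha : Tendsto a atTop (𝓝 0))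
    (hc : Tendsto (fun n => c n / a n) atTop (𝓝 0)) :
    ∃ φ : ℕ → ℕ, StrictMono φ ∧ (∀ n, |a (φ (n + 1))| ≤ |a (φ n)| / 2) ∧
      ∀ n, |c (φ (n + 1)) / a (φ (n + 1))| ≤ (1 / 2) ^ n := by
  have step : ∀ k n : ℕ, ∃ m, n < m ∧ |a m| ≤ |a n| / 2 ∧ |c m / a m| ≤ (1 / 2) ^ k := by
    intro k n
    have h1 : ∀ᶠ m in atTop, |a m| < |a n| / 2 := by
      have := ha.abs
      rw [abs_zero] at this
      exact this.eventually_lt_const (by have := abs_pos.mpr (ha0 n); positivity)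
    have h2 : ∀ᶠ m in atTop, |c m / a m| < (1 / 2) ^ k := by
      have := hc.abs
      rw [abs_zero] at this
      exact this.eventually_lt_const (by positivity)
    obtain ⟨m, hm, hm1, hm2⟩ := ((eventually_gt_atTop n).and (h1.and h2)).exists
    exact ⟨m, hm, hm1.le, hm2.le⟩
  choose F hF1 hF2 hF3 using step
  exact ⟨fun n => Nat.rec 0 F n, strictMono_nat_of_lt_succ fun n => hF1 _ _, fun n => hF2 _ _,
    fun n => hF3 _ _⟩

/-- A sequence of data which is superlinearly small at the origin can, after passing to a
subsequence, be interpolated by a C¹ function that is flat at the origin. -/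
theorem exists_C1_interpolation {a c : ℕ → ℝ} (ha0 : ∀ n, a n ≠ 0) (ha : Tendsto a atTop (𝓝 0))
    (hc : Tendsto (fun n => c n / a n) atTop (𝓝 0)) :
    ∃ φ : ℕ → ℕ, StrictMono φ ∧ ∃ g : ℝ → ℝ, ContDiff ℝ 1 g ∧ g 0 = 0 ∧ deriv g 0 = 0 ∧
      ∀ n, g (a (φ n)) = c (φ n) := by
  obtain ⟨φ, hφ, hhalf, hsmall⟩ := exists_subseq_geometric ha0 ha hc
  refine ⟨fun n => φ (n + 1), hφ.comp (strictMono_id.add_const 1), ?_⟩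
  set A : ℕ → ℝ := fun n => a (φ (n + 1))
  set B : ℕ → ℝ := fun n => c (φ (n + 1))
  have hA0 : ∀ n, A n ≠ 0 := fun n => ha0 _
  have hdecay : ∀ n m, n < m → |A m| ≤ |A n| / 2 := by
    intro n m hnm
    induction m, hnm using Nat.le_induction with
    | base => exact hhalf (n + 1)
    | succ m _ ih =>
      have h : |A (m + 1)| ≤ |A m| / 2 := hhalf (m + 1)
      linarith [abs_nonneg (A m)]
  let χ : ContDiffBump (0 : ℝ) := ⟨1 / 8, 1 / 4, by norm_num, by norm_num⟩
  have hχ1 : χ 0 = 1 := χ.one_of_mem_closedBall (by simp [χ])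
  have hχ0 : ∀ y : ℝ, 1 / 4 ≤ |y| → χ y = 0 := fun y hy => by
    refine χ.zero_of_le_dist ?_
    simpa [χ] using hy
  have hχC : ContDiff ℝ 1 χ := χ.contDiff
  have hχd : Differentiable ℝ χ := hχC.differentiable one_ne_zero
  have hχ' : Continuous (deriv χ) := (contDiff_one_iff_deriv.mp hχC).2
  obtain ⟨C, hC⟩ := χ.hasCompactSupport.deriv.exists_bound_of_continuous hχ'
  have hχneg : deriv χ (-1) = 0 := by
    have : (χ : ℝ → ℝ) =ᶠ[𝓝 (-1)] fun _ => 0 := by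
      filter_upwards [Iio_mem_nhds (show (-1 : ℝ) < -1 / 4 by norm_num)] with y hy
      refine hχ0 y ?_
      rw [Set.mem_Iio] at hy
      rw [abs_of_neg (by linarith)]
      linarith
    rw [this.deriv_eq, deriv_const]
  let G : ℕ → ℝ → ℝ := fun n y => B n * χ (y / A n - 1)
  let G' : ℕ → ℝ → ℝ := fun n y => B n * (deriv χ (y / A n - 1) * (1 / A n))
  have hG : ∀ n y, HasDerivAt (G n) (G' n y) y := fun n y => by
    have h1 : HasDerivAt (fun y => y / A n - 1) (1 / A n) y :=
      ((hasDerivAt_id y).div_const (A n)).sub_const 1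
    exact ((hχd _).hasDerivAt.comp y h1).const_mul (B n)
  have hbound : ∀ n y, ‖G' n y‖ ≤ (1 / 2) ^ n * C := fun n y => by
    have : G' n y = (B n / A n) * deriv χ (y / A n - 1) := by
      simp only [G']; ring
    rw [this, norm_mul]
    exact mul_le_mul (hsmall n) (hC _) (norm_nonneg _) (by positivity)
  have hsum : Summable fun n : ℕ => (1 / 2 : ℝ) ^ n * C := summable_geometric_two.mul_right C
  have hG0 : ∀ n, G n 0 = 0 := fun n => by
    simp only [G, zero_div, zero_sub]
    rw [hχ0 (-1) (by norm_num), mul_zero]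
  have hder := hasDerivAt_tsum hsum hG hbound (y₀ := 0) (by simp only [hG0]; exact summable_zero)
  have hderiv : deriv (fun z => ∑' n, G n z) = fun y => ∑' n, G' n y :=
    funext fun y => (hder y).deriv
  refine ⟨fun z => ∑' n, G n z, ?_, by simp [hG0], ?_, fun n => ?_⟩
  · refine contDiff_one_iff_deriv.mpr ⟨fun y => (hder y).differentiableAt, ?_⟩
    rw [hderiv]
    exact continuous_tsum (fun n => by simp only [G']; fun_prop) hsum hbound
  · rw [hderiv]
    simp [G', hχneg]
  · change ∑' m, G m (A n) = B n
    rw [tsum_eq_single n]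
    · simp [G, div_self (hA0 n), hχ1]
    · intro m hmn
      simp only [G]
      rw [hχ0, mul_zero]
      have hpos := abs_pos.mpr (hA0 m)
      have hfar : |A m| / 4 ≤ |A n - A m| := by
        rcases lt_or_gt_of_ne hmn with h | h
        · have := hdecay m n h
          have h2 := abs_sub_abs_le_abs_sub (A m) (A n)
          rw [abs_sub_comm] at h2
          linarith
        · have := hdecay n m h
          have h2 := abs_sub_abs_le_abs_sub (A n) (A m)
          linarith
      rw [div_sub_one (hA0 m), abs_div, le_div_iff₀ hpos]
      linarith

/-- The vector `v` rotated by a right angle. -/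
def rot (v : Plane) : Plane := (-v.2, v.1)

theorem eq_zero_of_smul_add_smul_rot {v : Plane} (hv : v ≠ 0) {a b : ℝ}
    (h : a • v + b • rot v = 0) : a = 0 ∧ b = 0 := by
  have hN := (normSq_pos hv).ne'
  have h1 := congrArg Prod.fst h
  have h2 := congrArg Prod.snd h
  simp only [rot, Prod.fst_add, Prod.snd_add, Prod.smul_fst, Prod.smul_snd, smul_eq_mul,
    Prod.fst_zero, Prod.snd_zero] at h1 h2
  constructor
  · refine (mul_eq_zero.mp ?_).resolve_right hN
    linear_combination v.1 * h1 + v.2 * h2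
  · refine (mul_eq_zero.mp ?_).resolve_right hN
    linear_combination v.1 * h2 - v.2 * h1

/-- The unit circle tangent to `v` at `q`, in the frame `v, rot v`, sheared by the graph of `g`. -/
def shearedCircle (q v : Plane) (g : ℝ → ℝ) (t : ℝ) : Plane :=
  q + (Real.sin (2 * Real.pi * t) • v +
    (1 - Real.cos (2 * Real.pi * t) + g (Real.sin (2 * Real.pi * t))) • rot v)

theorem hasDerivAt_shearedCircle (q v : Plane) {g : ℝ → ℝ} (hg : ContDiff ℝ 1 g) (t : ℝ) :
    HasDerivAt (shearedCircle q v g)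
      ((2 * Real.pi * Real.cos (2 * Real.pi * t)) • v +
        (2 * Real.pi * Real.sin (2 * Real.pi * t) + deriv g (Real.sin (2 * Real.pi * t)) *
          (2 * Real.pi * Real.cos (2 * Real.pi * t))) • rot v) t := by
  have hlin : HasDerivAt (fun t : ℝ => 2 * Real.pi * t) (2 * Real.pi) t := by
    simpa using (hasDerivAt_id t).const_mul (2 * Real.pi)
  have hsin : HasDerivAt (fun t : ℝ => Real.sin (2 * Real.pi * t))
      (2 * Real.pi * Real.cos (2 * Real.pi * t)) t := by
    simpa [mul_comm] using hlin.sin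
  have hcos : HasDerivAt (fun t : ℝ => 1 - Real.cos (2 * Real.pi * t))
      (2 * Real.pi * Real.sin (2 * Real.pi * t)) t := by
    simpa [mul_comm] using hlin.cos.const_sub 1
  have hgs := ((hg.differentiable one_ne_zero _).hasDerivAt).comp t hsin
  exact ((hsin.smul_const v).add ((hcos.add hgs).smul_const (rot v))).const_add q

theorem isRegParam_shearedCircle (q : Plane) {v : Plane} (hv : v ≠ 0) {g : ℝ → ℝ}
    (hg : ContDiff ℝ 1 g) : IsRegParam (shearedCircle q v g) := by
  refine ⟨?_, fun t => ?_, fun s hs t ht hst => ?_, fun t h0 => ?_⟩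
  · unfold shearedCircle
    have hs : ContDiff ℝ 1 fun t : ℝ => Real.sin (2 * Real.pi * t) := by fun_prop
    have hc : ContDiff ℝ 1 fun t : ℝ => Real.cos (2 * Real.pi * t) := by fun_prop
    exact contDiff_const.add ((hs.smul contDiff_const).add
      (((contDiff_const.sub hc).add (hg.comp hs)).smul contDiff_const))
  · simp [shearedCircle, mul_add, Real.sin_add_two_pi, Real.cos_add_two_pi]
  · have h := sub_eq_zero.mpr (add_left_cancel hst)
    rw [add_sub_add_comm, ← sub_smul, ← sub_smul] at h
    obtain ⟨h1, h2⟩ := eq_zero_of_smul_add_smul_rot hv h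
    have hsin := sub_eq_zero.mp h1
    rw [hsin] at h2
    have hcos : Real.cos (2 * Real.pi * s) = Real.cos (2 * Real.pi * t) := by linarith
    obtain ⟨k, hk⟩ := Real.Angle.angle_eq_iff_two_pi_dvd_sub.mp
      (Real.Angle.cos_sin_inj hcos hsin)
    have hk' : s - t = k := by
      refine mul_left_cancel₀ (mul_ne_zero two_ne_zero Real.pi_ne_zero) ?_
      rw [← hk]; ring
    have hlt : (k : ℝ) < 1 := by linarith [hs.2, ht.1]
    have hgt : (-1 : ℝ) < k := by linarith [hs.1, ht.2]
    have hlt' : k < 1 := by exact_mod_cast hlt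
    have hgt' : -1 < k := by exact_mod_cast hgt
    have hk0 : k = 0 := by omega
    rw [hk0, Int.cast_zero] at hk'
    linarith
  · rw [(hasDerivAt_shearedCircle q v hg t).deriv] at h0
    obtain ⟨h1, h2⟩ := eq_zero_of_smul_add_smul_rot hv h0
    rw [h1, mul_zero, add_zero] at h2
    have hpi : 2 * Real.pi ≠ 0 := mul_ne_zero two_ne_zero Real.pi_ne_zero
    have hc := (mul_eq_zero.mp h1).resolve_left hpi
    have hs := (mul_eq_zero.mp h2).resolve_left hpi
    have := Real.sin_sq_add_cos_sq (2 * Real.pi * t)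
    rw [hc, hs] at this
    norm_num at this

theorem tangentAt_shearedCircle (q : Plane) {v : Plane} (hv : v ≠ 0) {g : ℝ → ℝ}
    (hg : ContDiff ℝ 1 g) (hg0 : g 0 = 0) (hg' : deriv g 0 = 0) :
    TangentAt (Set.range (shearedCircle q v g)) q (Projectivization.mk ℝ v hv) := by
  refine ⟨_, 0, isRegParam_shearedCircle q hv hg, rfl, by simp [shearedCircle, hg0], ?_⟩
  refine mk_eq_mk_of_planeCross_eq_zero _ _ ?_
  rw [(hasDerivAt_shearedCircle q v hg 0).deriv]
  simp only [mul_zero, Real.cos_zero, Real.sin_zero, hg', zero_mul, add_zero, zero_smul, planeCross,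
    Prod.smul_fst, Prod.smul_snd, smul_eq_mul]
  ring

theorem mem_range_shearedCircle (q v : Plane) (g : ℝ → ℝ) {a : ℝ} (ha : |a| ≤ 1) :
    q + (a • v + (1 - √(1 - a ^ 2) + g a) • rot v) ∈ Set.range (shearedCircle q v g) := by
  refine ⟨Real.arcsin a / (2 * Real.pi), ?_⟩
  have : 2 * Real.pi * (Real.arcsin a / (2 * Real.pi)) = Real.arcsin a :=
    mul_div_cancel₀ _ (mul_ne_zero two_ne_zero Real.pi_ne_zero)
  rw [shearedCircle, this, Real.cos_arcsin,
    Real.sin_arcsin (abs_le.mp ha).1 (abs_le.mp ha).2]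

theorem abs_one_sub_sqrt_le (a : ℝ) : |1 - √(1 - a ^ 2)| ≤ a ^ 2 := by
  have h1 : √(1 - a ^ 2) ≤ 1 := Real.sqrt_le_one.mpr (by nlinarith [sq_nonneg a])
  rw [abs_of_nonneg (by linarith)]
  rcases le_total (a ^ 2) 1 with h | h
  · have := Real.le_sqrt_of_sq_le (show (1 - a ^ 2) ^ 2 ≤ 1 - a ^ 2 by nlinarith [sq_nonneg a])
    linarith
  · linarith [Real.sqrt_nonneg (1 - a ^ 2)]

theorem exists_curve_through_subseq_of_frame {q v : Plane} (hv : v ≠ 0) {a b : ℕ → ℝ}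
    (ha0 : ∀ n, a n ≠ 0) (ha1 : ∀ n, |a n| ≤ 1) (ha : Tendsto a atTop (𝓝 0))
    (hb : Tendsto (fun n => b n / a n) atTop (𝓝 0)) :
    ∃ φ : ℕ → ℕ, StrictMono φ ∧ ∃ Γ : Set Plane, TangentAt Γ q (Projectivization.mk ℝ v hv) ∧
      ∀ n, q + (a (φ n) • v + b (φ n) • rot v) ∈ Γ := by
  have hc : Tendsto (fun n => (b n - (1 - √(1 - a n ^ 2))) / a n) atTop (𝓝 0) := by
    have h : Tendsto (fun n => (1 - √(1 - a n ^ 2)) / a n) atTop (𝓝 0) := by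
      refine squeeze_zero_norm (fun n => ?_) (by simpa using ha.abs)
      rw [Real.norm_eq_abs, abs_div, div_le_iff₀ (abs_pos.mpr (ha0 n)), abs_mul_abs_self, ← sq]
      exact abs_one_sub_sqrt_le _
    simpa [sub_div] using hb.sub h
  obtain ⟨φ, hφ, g, hg, hg0, hg', hgc⟩ := exists_C1_interpolation ha0 ha hc
  refine ⟨φ, hφ, _, tangentAt_shearedCircle q hv hg hg0 hg', fun n => ?_⟩
  have h := mem_range_shearedCircle q v g (ha1 (φ n))
  rwa [hgc, add_sub_cancel] at h

/-- A sequence converging to `q` with secant directions converging to the line of `v` has a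
subsequence lying on a simple closed C¹ curve tangent to `v` at `q`. -/
theorem exists_curve_through_subseq {q v : Plane} (hv : v ≠ 0) {x : ℕ → Plane}
    (hxq : ∀ n, x n ≠ q) (hx : Tendsto x atTop (𝓝 q))
    (hu : Tendsto (fun n => unitSecant q (x n)) atTop (𝓝 v)) :
    ∃ φ : ℕ → ℕ, StrictMono φ ∧ ∃ Γ : Set Plane, TangentAt Γ q (Projectivization.mk ℝ v hv) ∧
      ∀ n, x (φ n) ∈ Γ := by
  have hN := (normSq_pos hv).ne'
  let N : ℝ := v.1 ^ 2 + v.2 ^ 2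
  let α : Plane → ℝ := fun u => (u.1 * v.1 + u.2 * v.2) / N
  let β : Plane → ℝ := fun u => planeCross v u / N
  have hdecomp : ∀ u, α u • v + β u • rot v = u := fun u => by
    refine Prod.ext ?_ ?_ <;>
    · simp only [α, β, N, planeCross, rot, Prod.fst_add, Prod.snd_add, Prod.smul_fst, Prod.smul_snd,
        smul_eq_mul]
      field_simp
      ring
  have hα : Tendsto (fun n => α (unitSecant q (x n))) atTop (𝓝 1) := by
    have hcont : Continuous α := by simp only [α]; fun_prop
    have hαv : α v = 1 := by
      simp only [α, N, ← sq]
      exact div_self hN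
    exact hαv ▸ (hcont.tendsto v).comp hu
  have hβ : Tendsto (fun n => β (unitSecant q (x n))) atTop (𝓝 0) := by
    have hcont : Continuous β := by simp only [β, planeCross]; fun_prop
    have hβv : β v = 0 := by simp [β, planeCross_self]
    exact hβv ▸ (hcont.tendsto v).comp hu
  have hnorm : Tendsto (fun n => ‖x n - q‖) atTop (𝓝 0) := by
    simpa using (hx.sub_const q).norm
  have hnorm0 : ∀ n, ‖x n - q‖ ≠ 0 := fun n => norm_ne_zero_iff.mpr (sub_ne_zero.mpr (hxq n))
  let a : ℕ → ℝ := fun n => ‖x n - q‖ * α (unitSecant q (x n))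
  let b : ℕ → ℝ := fun n => ‖x n - q‖ * β (unitSecant q (x n))
  have hxab : ∀ n, q + (a n • v + b n • rot v) = x n := fun n => by
    simp only [a, b, mul_smul]
    rw [← smul_add, hdecomp, norm_smul_unitSecant (hxq n), add_sub_cancel]
  have ha : Tendsto a atTop (𝓝 0) := by simpa using hnorm.mul hα
  have hb : Tendsto (fun n => b n / a n) atTop (𝓝 0) := by
    have h := hβ.div hα one_ne_zero
    rw [zero_div] at h
    exact h.congr fun n => (mul_div_mul_left _ _ (hnorm0 n)).symm
  have ha1 : ∀ᶠ n in atTop, |a n| ≤ 1 := by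
    have h := ha.abs
    rw [abs_zero] at h
    exact (h.eventually_lt_const one_pos).mono fun _ => le_of_lt
  have ha0 : ∀ᶠ n in atTop, a n ≠ 0 :=
    (hα.eventually_ne one_ne_zero).mono fun n h => mul_ne_zero (hnorm0 n) h
  obtain ⟨M, hM⟩ := eventually_atTop.mp (ha0.and ha1)
  obtain ⟨φ, hφ, Γ, hΓ, hmem⟩ := exists_curve_through_subseq_of_frame (q := q) hv
    (a := fun n => a (n + M)) (b := fun n => b (n + M))
    (fun n => (hM _ (Nat.le_add_left M n)).1) (fun n => (hM _ (Nat.le_add_left M n)).2)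
    (ha.comp (tendsto_add_atTop_nat M)) (hb.comp (tendsto_add_atTop_nat M))
  refine ⟨fun n => φ n + M, hφ.add_const M, Γ, hΓ, fun n => ?_⟩
  rw [← hxab]
  exact hmem n

theorem IsC1Curve.exists_tangentAt {Γ : Set Plane} (hΓ : IsC1Curve Γ) {p : Plane} (hp : p ∈ Γ) :
    ∃ m, TangentAt Γ p m := by
  obtain ⟨γ, hγ, rfl⟩ := hΓ
  obtain ⟨t₀, ht₀⟩ := hp
  exact ⟨_, γ, t₀, hγ, rfl, ht₀, rfl⟩

/-- Every limit of secant directions at `q` within `f ⁻¹' Γ` is mapped to the tangent line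
of `Γ` at `f q`. -/
theorem InducesAt.mk_limit_eq {f : Plane ≃ₜ Plane} {q v : Plane} {Φ : ProjLine ≃ₜ ProjLine}
    (hΦ : InducesAt ⇑f q Φ) {Γ : Set Plane} {m : ProjLine} (hm : TangentAt Γ (f q) m)
    (hv : v ≠ 0) {x : ℕ → Plane} (hxq : ∀ n, x n ≠ q) (hx : Tendsto x atTop (𝓝 q))
    (hmem : ∀ n, f (x n) ∈ Γ) (hu : Tendsto (fun n => unitSecant q (x n)) atTop (𝓝 v)) :
    Φ (Projectivization.mk ℝ v hv) = m := by
  obtain ⟨φ, hφ, Γ', hΓ', hmem'⟩ := exists_curve_through_subseq hv hxq hx hu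
  have himg : ∀ n, f (x n) ≠ f q := fun n h => hxq n (f.injective h)
  obtain ⟨w, hw, θ, hθ, hlim⟩ := exists_subseq_unitSecant_tendsto fun n => himg (φ n)
  have hconv : Tendsto (fun n => f (x (φ (θ n)))) atTop (𝓝 (f q)) :=
    (f.continuous.tendsto q).comp (hx.comp (hφ.comp hθ).tendsto_atTop)
  rw [← hm.mk_eq hw (fun n => himg (φ (θ n))) hconv (fun n => hmem _) hlim,
    ← (hΦ Γ' _ hΓ').2.mk_eq hw (fun n => himg (φ (θ n))) hconv
      (fun n => Set.mem_image_of_mem f (hmem' _)) hlim]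

/-- If `f` maps every C¹ curve to a C¹ curve and induces homeomorphisms of projective
tangent spaces at every point, then the preimage of every simple closed C¹ curve has a
well-defined tangent line at each of its points. -/
theorem preimage_has_tangent_lines (f : Plane ≃ₜ Plane)
    (hmaps : MapsC1 ⇑f)
    (hind : ∀ q : Plane, ∃ φ : ProjLine ≃ₜ ProjLine, InducesAt ⇑f q φ)
    (Γ : Set Plane) (hΓ : IsC1Curve Γ) (q : Plane) (hq : q ∈ ⇑f ⁻¹' Γ) :
    ∃ ℓ : ProjLine,
      Tendsto (secantDir q) (𝓝[(⇑f ⁻¹' Γ) \ {q}] q) (𝓝 ℓ) := by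
  obtain ⟨Φ, hΦ⟩ := hind q
  obtain ⟨m, hm⟩ := hΓ.exists_tangentAt hq
  refine ⟨Φ.symm m, tendsto_nhds.mpr fun U hU hmU => ?_⟩
  by_contra hnot
  have hfreq : ∃ᶠ x in 𝓝[(⇑f ⁻¹' Γ) \ {q}] q, secantDir q x ∉ U ∧ x ∈ (⇑f ⁻¹' Γ) \ {q} :=
    (not_eventually.mp hnot).and_eventually self_mem_nhdsWithin
  obtain ⟨x, hx, hxP⟩ := exists_seq_forall_of_frequently hfreq
  have hxq : ∀ n, x n ≠ q := fun n => (hxP n).2.2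
  obtain ⟨v, hv, φ, hφ, hlim⟩ := exists_subseq_unitSecant_tendsto hxq
  have hxφ : Tendsto (fun n => x (φ n)) atTop (𝓝 q) :=
    (tendsto_nhds_of_tendsto_nhdsWithin hx).comp hφ.tendsto_atTop
  have hvm : Φ (Projectivization.mk ℝ v hv) = m :=
    hΦ.mk_limit_eq hm hv (fun n => hxq (φ n)) hxφ (fun n => (hxP (φ n)).2.1) hlim
  rw [← hvm, Homeomorph.symm_apply_apply] at hmU
  obtain ⟨n, hn⟩ := ((tendsto_secantDir_of_unitSecant hv (fun n => hxq (φ n)) hlim).eventually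
    (hU.mem_nhds hmU)).exists
  exact (hxP (φ n)).1 hn
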